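/- There exists a Hadamard matrix of order 32996 = 4·8249. -/

import Mathlib

open Finset Matrix Kronecker

/-- Nonperiodic autocorrelation `N_X(j)` of a sequence of length `m` (0-indexed):
`N_X(j) = ∑_{k=0}^{m-j-1} x_k x_{k+j}`. -/
def autocorr (m : ℕ) (X : ℕ → ℤ) (j : ℕ) : ℤ :=
  ∑ k ∈ Finset.range (m - j), X k * X (k + j)

/-- A binary (±1) sequence of length `m`. -/
def IsBinarySeq (m : ℕ) (X : ℕ → ℤ) : Prop :=
  ∀ i < m, X i = 1 ∨ X i = -1

/-- Base sequences `BS(r,s)`: binary sequences `A, B` of length `r` and `C, D` of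
length `s` whose nonperiodic autocorrelations sum to zero for all `j ≥ 1`. -/
def IsBaseSeq (r s : ℕ) (A B C D : ℕ → ℤ) : Prop :=
  IsBinarySeq r A ∧ IsBinarySeq r B ∧ IsBinarySeq s C ∧ IsBinarySeq s D ∧
    ∀ j, 1 ≤ j →
      autocorr r A j + autocorr r B j + autocorr s C j + autocorr s D j = 0

/-- A Golay pair of length `g`. -/
def IsGolayPair (g : ℕ) (A B : ℕ → ℤ) : Prop :=
  IsBinarySeq g A ∧ IsBinarySeq g B ∧
    ∀ j, 1 ≤ j → autocorr g A j + autocorr g B j = 0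

/-- Normal sequences `NS(n)`: base sequences in `BS(n+1,n)` whose first two
sequences agree in the first `n` entries. -/
def IsNormalSeq (n : ℕ) (A B C D : ℕ → ℤ) : Prop :=
  IsBaseSeq (n + 1) n A B C D ∧ ∀ i < n, B i = A i

/-- Near-normal sequences `NN(n)`: base sequences in `BS(n+1,n)` with
`b_i = (-1)^(i-1) a_i` for `i = 1, …, n` (0-indexed: `B i = (-1)^i * A i`). -/
def IsNearNormalSeq (n : ℕ) (A B C D : ℕ → ℤ) : Prop :=
  IsBaseSeq (n + 1) n A B C D ∧ ∀ i < n, B i = (-1) ^ i * A i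

/-- T-sequences of length `t`: four `{-1,0,1}`-sequences such that at every
position exactly one of them is nonzero, and the sum of their nonperiodic
autocorrelations vanishes for all `j ≥ 1`. -/
def IsTSeq (t : ℕ) (T₁ T₂ T₃ T₄ : ℕ → ℤ) : Prop :=
  (∀ i < t, T₁ i ∈ ({-1, 0, 1} : Set ℤ)) ∧
  (∀ i < t, T₂ i ∈ ({-1, 0, 1} : Set ℤ)) ∧
  (∀ i < t, T₃ i ∈ ({-1, 0, 1} : Set ℤ)) ∧
  (∀ i < t, T₄ i ∈ ({-1, 0, 1} : Set ℤ)) ∧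
  (∀ i < t,
    (T₁ i ≠ 0 ∧ T₂ i = 0 ∧ T₃ i = 0 ∧ T₄ i = 0) ∨
    (T₁ i = 0 ∧ T₂ i ≠ 0 ∧ T₃ i = 0 ∧ T₄ i = 0) ∨
    (T₁ i = 0 ∧ T₂ i = 0 ∧ T₃ i ≠ 0 ∧ T₄ i = 0) ∨
    (T₁ i = 0 ∧ T₂ i = 0 ∧ T₃ i = 0 ∧ T₄ i ≠ 0)) ∧
  ∀ j, 1 ≤ j →
    autocorr t T₁ j + autocorr t T₂ j + autocorr t T₃ j + autocorr t T₄ j = 0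

/-- An orthogonal design `OD(4d; d,d,d,d)`: four `4d × 4d` matrices with entries
in `{-1,0,1}`, pairwise disjoint supports covering every position, with
`Aᵢ Aᵢᵀ = d·I` and `Aᵢ Aⱼᵀ + Aⱼ Aᵢᵀ = 0` for `i ≠ j`. -/
def IsOD (d : ℕ) (A : Fin 4 → Matrix (Fin (4 * d)) (Fin (4 * d)) ℤ) : Prop :=
  (∀ k i j, A k i j ∈ ({-1, 0, 1} : Set ℤ)) ∧
  (∀ i j, ∃! k : Fin 4, A k i j ≠ 0) ∧
  (∀ k, A k * (A k)ᵀ = (d : ℤ) • 1) ∧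
  (∀ k l, k ≠ l → A k * (A l)ᵀ + A l * (A k)ᵀ = 0)

/-- Williamson-type matrices of order `w`: four pairwise amicable `±1` matrices
with `∑ Wᵢ Wᵢᵀ = 4w·I`. -/
def IsWilliamsonType (w : ℕ) (W : Fin 4 → Matrix (Fin w) (Fin w) ℤ) : Prop :=
  (∀ k i j, W k i j = 1 ∨ W k i j = -1) ∧
  (∀ k l, W k * (W l)ᵀ = W l * (W k)ᵀ) ∧
  (∑ k, W k * (W k)ᵀ) = ((4 * w : ℕ) : ℤ) • 1

/-- A Hadamard matrix: a `±1` matrix `H` with `H Hᵀ = m·I`, where `m` is the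
size of the (finite) index type. -/
def IsHadamardMatrix {n : Type*} [Fintype n] [DecidableEq n] (H : Matrix n n ℤ) : Prop :=
  (∀ i j, H i j = 1 ∨ H i j = -1) ∧ H * Hᵀ = (Fintype.card n : ℤ) • 1

/-- The Goethals–Seidel array, as a `4 × 4` matrix of blocks. -/
def goethalsSeidel {κ : Type*} [Fintype κ] (A B C D R : Matrix κ κ ℤ) :
    Matrix (Fin 4) (Fin 4) (Matrix κ κ ℤ) :=
  !![A, B * R, C * R, D * R;
    -(B * R), A, Dᵀ * R, -(Cᵀ * R);
    -(C * R), -(Dᵀ * R), A, Bᵀ * R;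
    -(D * R), Cᵀ * R, -(Bᵀ * R), A]

theorem goethalsSeidel_mul_transpose {κ : Type*} [Fintype κ] [DecidableEq κ]
    {A B C D R : Matrix κ κ ℤ} {N : ℤ} {S : Set (Matrix κ κ ℤ)}
    (hA : A ∈ S) (hB : B ∈ S) (hC : C ∈ S) (hD : D ∈ S)
    (hT : ∀ X ∈ S, Xᵀ ∈ S) (hcomm : ∀ X ∈ S, ∀ Y ∈ S, X * Y = Y * X)
    (hR : R * R = 1) (hRt : Rᵀ = R) (hRX : ∀ X ∈ S, R * X = Xᵀ * R)
    (hsum : A * Aᵀ + B * Bᵀ + C * Cᵀ + D * Dᵀ = N • 1) (a b : Fin 4) :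
    ∑ c, goethalsSeidel A B C D R a c * (goethalsSeidel A B C D R b c)ᵀ =
      if a = b then N • 1 else 0 := by
  have hsymm : ∀ X ∈ S, (X * R)ᵀ = X * R := fun X hX => by
    rw [transpose_mul, hRt, hRX _ (hT X hX), transpose_transpose]
  have hRR : ∀ X, ∀ Y ∈ S, X * R * (Y * R) = X * Yᵀ := fun X Y hY => by
    rw [← Matrix.mul_assoc, Matrix.mul_assoc X, hRX Y hY, ← Matrix.mul_assoc, Matrix.mul_assoc, hR,
      Matrix.mul_one]
  have hXRY : ∀ X, ∀ Y ∈ S, X * R * Yᵀ = X * Y * R := fun X Y hY => by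
    rw [Matrix.mul_assoc, hRX _ (hT Y hY), transpose_transpose, Matrix.mul_assoc]
  have hA' := hT A hA
  have hB' := hT B hB
  have hC' := hT C hC
  have hD' := hT D hD
  have key : ∀ X ∈ S, ∀ Y ∈ S, X * (Y * R) = Y * X * R := fun X hX Y hY => by
    rw [← Matrix.mul_assoc, hcomm X hX Y hY]
  fin_cases a <;> fin_cases b <;>
    simp [goethalsSeidel, Fin.sum_univ_four, hsymm, hRR, hXRY, key, ← hsum, hA, hB, hC, hD,
      hB', hC', hD'] <;>
    (try simp only [hcomm _ hB' _ hB, hcomm _ hC' _ hC, hcomm _ hD' _ hD, hcomm _ hD _ hA,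
      hcomm _ hC _ hB, hcomm _ hD _ hB, hcomm _ hD _ hC, hcomm _ hC' _ hA, hcomm _ hC' _ hB,
      hcomm _ hD' _ hB, hcomm _ hD' _ hC, hcomm _ hC _ hB', hcomm _ hD _ hB', hcomm _ hD _ hC',
      hcomm _ hC' _ hB', hcomm _ hD' _ hB', hcomm _ hD' _ hC']) <;>
    abel

theorem circulant_kronecker_comm {G m κ : Type*} [AddCommGroup G] [Fintype G] [Fintype m]
    [Fintype κ] {X : κ → Matrix m m ℤ} (hX : ∀ k l, X k * X l = X l * X k) (s t : κ → G → ℤ) :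
    (∑ k, circulant (s k) ⊗ₖ X k) * (∑ k, circulant (t k) ⊗ₖ X k) =
      (∑ k, circulant (t k) ⊗ₖ X k) * (∑ k, circulant (s k) ⊗ₖ X k) := by
  simp only [Finset.sum_mul_sum, ← mul_kronecker_mul]
  rw [Finset.sum_comm]
  simp only [circulant_mul_comm (s _) (t _), hX]

theorem goethalsSeidel_circulant_sum {G m : Type*} [AddCommGroup G] [Fintype G] [DecidableEq G]
    [Fintype m] [DecidableEq m] {T : Fin 4 → G → ℤ} {X : Fin 4 → Matrix m m ℤ} {M N : ℤ}
    (hXt : ∀ k, (X k)ᵀ = X k) (hX : ∀ k l, X k * X l = X l * X k)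
    (hXsum : ∑ k, X k * X k = M • 1)
    (hT : ∑ i, circulant (T i) * (circulant (T i))ᵀ = N • 1)
    {Q : (Fin 4 → G → ℤ) → Matrix (G × m) (G × m) ℤ}
    (hQ : ∀ t, Q t = ∑ k, circulant (t k) ⊗ₖ X k) :
    Q ![T 0, T 1, T 2, T 3] * (Q ![T 0, T 1, T 2, T 3])ᵀ +
      Q ![T 1, -T 0, -T 3, T 2] * (Q ![T 1, -T 0, -T 3, T 2])ᵀ +
      Q ![T 2, T 3, -T 0, -T 1] * (Q ![T 2, T 3, -T 0, -T 1])ᵀ +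
      Q ![T 3, -T 2, T 1, -T 0] * (Q ![T 3, -T 2, T 1, -T 0])ᵀ = (N * M) • 1 := by
  have h : (∑ i, circulant (T i) * (circulant (T i))ᵀ) ⊗ₖ (∑ k, X k * X k) =
      (N * M) • (1 : Matrix (G × m) (G × m) ℤ) := by
    rw [hT, hXsum, smul_kronecker, kronecker_smul, one_kronecker_one, smul_smul]
  have hneg : ∀ (P : Matrix G G ℤ) (Y : Matrix m m ℤ), (-P) ⊗ₖ Y = -(P ⊗ₖ Y) := fun P Y => by
    ext; simp
  have htr : ∀ (P : Matrix G G ℤ) (k : Fin 4), (P ⊗ₖ X k)ᵀ = Pᵀ ⊗ₖ X k := fun P k => by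
    rw [← kroneckerMap_transpose, hXt]
  rw [← h]
  simp only [hQ, Fin.sum_univ_four, add_kronecker, kronecker_add]
  simp only [Matrix.cons_val, circulant_neg, hneg, htr, transpose_add, transpose_neg,
    Matrix.add_mul, Matrix.mul_add, Matrix.neg_mul, Matrix.mul_neg,
    ← mul_kronecker_mul]
  simp only [hX 1 0, hX 2 0, hX 3 0, hX 2 1, hX 3 1, hX 3 2]
  abel

theorem isHadamardMatrix_goethalsSeidel {κ : Type*} [Fintype κ] [DecidableEq κ]
    {A B C D : Matrix κ κ ℤ} {σ : Equiv.Perm κ} (hσ : ∀ p, σ (σ p) = p)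
    {S : Set (Matrix κ κ ℤ)} (hA : A ∈ S) (hB : B ∈ S) (hC : C ∈ S) (hD : D ∈ S)
    (hentry : ∀ X ∈ ({A, B, C, D} : Set (Matrix κ κ ℤ)), ∀ i j, X i j = 1 ∨ X i j = -1)
    (hT : ∀ X ∈ S, Xᵀ ∈ S) (hcomm : ∀ X ∈ S, ∀ Y ∈ S, X * Y = Y * X)
    (hσX : ∀ X ∈ S, ∀ i j, X (σ i) j = X (σ j) i)
    (hsum : A * Aᵀ + B * Bᵀ + C * Cᵀ + D * Dᵀ = ((4 * Fintype.card κ : ℕ) : ℤ) • 1) :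
    IsHadamardMatrix (Matrix.of fun p q : Fin 4 × κ =>
      goethalsSeidel A B C D ((1 : Matrix κ κ ℤ).submatrix id σ) p.1 q.1 p.2 q.2) := by
  set R := (1 : Matrix κ κ ℤ).submatrix id σ with hRdef
  have hσ' : ∀ p q, p = σ q ↔ q = σ p := fun p q =>
    ⟨fun h => by rw [h, hσ], fun h => by rw [h, hσ]⟩
  have hXR : ∀ (X : Matrix κ κ ℤ) i j, (X * R) i j = X i (σ j) := fun X i j => by
    simp [hRdef, mul_apply, one_apply]
  have hRX : ∀ (X : Matrix κ κ ℤ) i j, (R * X) i j = X (σ i) j := fun X i j => by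
    simp [hRdef, mul_apply, one_apply, hσ' i]
  have hgram := goethalsSeidel_mul_transpose (R := R) hA hB hC hD hT hcomm
    (by ext i j; rw [hRX, hRdef]; simp [one_apply])
    (by ext i j; simp only [hRdef, transpose_apply, submatrix_apply, one_apply, id]
        exact if_congr (hσ' j i) rfl rfl)
    (fun X hX => by ext i j; rw [hRX, hXR, transpose_apply, hσX X hX]) hsum
  constructor
  · rintro ⟨a, x⟩ ⟨b, y⟩
    have hA' := hentry A (by simp)
    have hB' := hentry B (by simp)
    have hC' := hentry C (by simp)
    have hD' := hentry D (by simp)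
    have hneg : ∀ z : ℤ, z = 1 ∨ z = -1 → -z = 1 ∨ -z = -1 := by omega
    fin_cases a <;> fin_cases b <;>
      simp only [goethalsSeidel, of_apply, Matrix.cons_val, Fin.zero_eta, Fin.mk_one,
        Fin.reduceFinMk, Matrix.neg_apply, hXR, transpose_apply] <;>
      first | apply hA' | apply hB' | apply hC' | apply hD' | (apply hneg; first
        | apply hA' | apply hB' | apply hC' | apply hD')
  · ext ⟨a, x⟩ ⟨b, y⟩
    have h := congrFun₂ (hgram a b) x y
    rw [mul_apply, Fintype.sum_prod_type]
    simp only [Matrix.sum_apply, mul_apply, transpose_apply] at h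
    simp only [of_apply, transpose_apply]
    rw [h]
    by_cases hab : a = b <;> simp [hab, one_apply, Prod.ext_iff]

/-- A Hadamard matrix from T-matrices (given as sequences over an abelian group) and symmetric
Williamson-type matrices. -/
theorem exists_isHadamardMatrix_of_tMatrices {G m : Type*} [AddCommGroup G] [Fintype G]
    [DecidableEq G] [Fintype m] [DecidableEq m] {T : Fin 4 → G → ℤ} {X : Fin 4 → Matrix m m ℤ}
    (hTentry : ∀ g, ∃ i, (T i g = 1 ∨ T i g = -1) ∧ ∀ j, j ≠ i → T j g = 0)
    (hT : ∑ i, circulant (T i) * (circulant (T i))ᵀ = (Fintype.card G : ℤ) • 1)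
    (hXentry : ∀ k i j, X k i j = 1 ∨ X k i j = -1)
    (hXt : ∀ k, (X k)ᵀ = X k) (hX : ∀ k l, X k * X l = X l * X k)
    (hXsum : ∑ k, X k * X k = ((4 * Fintype.card m : ℕ) : ℤ) • 1) :
    ∃ H : Matrix (Fin 4 × G × m) (Fin 4 × G × m) ℤ, IsHadamardMatrix H := by
  set Q : (Fin 4 → G → ℤ) → Matrix (G × m) (G × m) ℤ :=
    fun t => ∑ k, circulant (t k) ⊗ₖ X k with hQ
  have hQt : ∀ t, (Q t)ᵀ = Q fun k g => t k (-g) := fun t => by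
    simp only [hQ, transpose_sum, ← kroneckerMap_transpose, hXt, transpose_circulant]
  have hQapp : ∀ t g x h y, Q t (g, x) (h, y) = ∑ k, t k (g - h) * X k x y := by
    intro t g x h y
    simp [hQ, Matrix.sum_apply]
  have hXsymm : ∀ k x y, X k x y = X k y x := fun k x y => congrFun₂ (hXt k) y x
  refine ⟨_, isHadamardMatrix_goethalsSeidel
    (σ := (Equiv.neg G).prodCongr (Equiv.refl m)) (S := Set.range Q) ?_
    ⟨![T 0, T 1, T 2, T 3], rfl⟩ ⟨![T 1, -T 0, -T 3, T 2], rfl⟩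
    ⟨![T 2, T 3, -T 0, -T 1], rfl⟩ ⟨![T 3, -T 2, T 1, -T 0], rfl⟩ ?_ ?_ ?_ ?_ ?_⟩
  · simp
  · rintro Y hY ⟨g, x⟩ ⟨h, y⟩
    obtain ⟨i, hi, hj⟩ := hTentry (g - h)
    have hX0 := hXentry 0 x y
    have hX1 := hXentry 1 x y
    have hX2 := hXentry 2 x y
    have hX3 := hXentry 3 x y
    have hsgn : ∀ a b : ℤ, (a = 1 ∨ a = -1) → (b = 1 ∨ b = -1) →
        (a * b = 1 ∨ a * b = -1) ∧ (-(a * b) = 1 ∨ -(a * b) = -1) := by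
      rintro a b (rfl | rfl) (rfl | rfl) <;> simp
    simp only [Set.mem_insert_iff, Set.mem_singleton_iff] at hY
    have h0 := hj 0
    have h1 := hj 1
    have h2 := hj 2
    have h3 := hj 3
    rcases hY with rfl | rfl | rfl | rfl <;> rw [hQapp] <;> fin_cases i <;>
      simp_all [Fin.sum_univ_four]
  · rintro _ ⟨t, rfl⟩
    exact ⟨_, (hQt t).symm⟩
  · rintro _ ⟨s, rfl⟩ _ ⟨t, rfl⟩
    exact circulant_kronecker_comm hX s t
  · rintro _ ⟨t, rfl⟩ ⟨g, x⟩ ⟨h, y⟩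
    simp only [Equiv.prodCongr_apply, Prod.map_apply, Equiv.neg_apply, Equiv.refl_apply, hQapp]
    refine Finset.sum_congr rfl fun k _ => ?_
    rw [hXsymm k x y, neg_sub_comm]
  · rw [goethalsSeidel_circulant_sum hXt hX hXsum hT fun _ => rfl, Fintype.card_prod]
    congr 1
    push_cast
    ring

theorem IsHadamardMatrix.reindex {n n' : Type*} [Fintype n] [DecidableEq n] [Fintype n']
    [DecidableEq n'] {H : Matrix n n ℤ} (hH : IsHadamardMatrix H) (e : n ≃ n') :
    IsHadamardMatrix (Matrix.reindex e e H) := by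
  refine ⟨fun i j => hH.1 _ _, ?_⟩
  rw [reindex_apply, transpose_submatrix, submatrix_mul_equiv, hH.2, Fintype.card_congr e]
  ext i j
  simp only [Matrix.smul_apply, submatrix_apply, one_apply, EmbeddingLike.apply_eq_iff_eq]

/-- `tData[x] = ±(i + 1)` encodes that the `i`-th T-sequence of length `73` takes the value `±1`
at `x`, the others being zero there. -/
def tData : List ℤ :=
  [1, -3, 3, -4, 2, 1, -1, 2, -3, 4, 2, 3, -3, -1, -4, 3, 3, 3, 1, -1, -4, 4, 4, -3, -4, 2, 2, 1,
    1, -1, 4, -1, 2, -1, -3, -2, -2, 2, -3, -4, 1, -2, -4, -4, -4, -1, -4, 3, -1, 1, -2, -4, -4,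
    -3, 2, 3, 2, 1, 2, -3, -4, -2, 2, 3, -3, 4, 3, 2, -1, -2, 1, 1, 4]

/-- The four T-sequences encoded by `tData`, indexed by the residues modulo `73`. -/
def tSeq (i : Fin 4) (x : ZMod 73) : ℤ :=
  if (tData.getD x.val 0).natAbs = i.val + 1 then (tData.getD x.val 0).sign else 0

theorem tSeq_entry : ∀ x, ∃ i, (tSeq i x = 1 ∨ tSeq i x = -1) ∧ ∀ j, j ≠ i → tSeq j x = 0 := by
  decide +kernel

theorem tSeq_autocorrelation :
    ∀ d, ∑ i, ∑ x, tSeq i (d - x) * tSeq i (-x) = if d = 0 then 73 else 0 := by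
  decide +kernel

theorem tSeq_circulant :
    ∑ i, circulant (tSeq i) * (circulant (tSeq i))ᵀ = (Fintype.card (ZMod 73) : ℤ) • 1 := by
  ext i j
  have h := tSeq_autocorrelation (i - j)
  simp only [transpose_circulant, circulant_mul, Matrix.sum_apply, circulant_apply, mulVec,
    dotProduct, Matrix.smul_apply, one_apply, sub_eq_zero, ZMod.card] at h ⊢
  rw [h]
  simp

/-- The bordered `2 × 2` block matrix in Miyamoto's construction. -/
def miyamoto {ι : Type*} (c : ℤ) (U V : Matrix ι ι ℤ) : Matrix (Unit ⊕ ι ⊕ ι) (Unit ⊕ ι ⊕ ι) ℤ :=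
  fromBlocks (of fun _ _ => c) (of fun _ _ => 1) (of fun _ _ => 1)
    (fromBlocks (U + V) (U - V) (U - V) (U + V))

theorem miyamoto_mul {ι : Type*} [Fintype ι] {c c' u u' : ℤ} {U V U' V' : Matrix ι ι ℤ}
    (hu : ∀ i, ∑ j, U i j = u) (hu' : ∀ j, ∑ i, U' i j = u') :
    miyamoto c U V * miyamoto c' U' V' =
      fromBlocks (of fun _ _ => c * c' + 2 * Fintype.card ι) (of fun _ _ => c + 2 * u')
        (of fun _ _ => c' + 2 * u)
        (fromBlocks (of (fun _ _ => 1) + 2 • (U * U' + V * V'))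
          (of (fun _ _ => 1) + 2 • (U * U' - V * V'))
          (of (fun _ _ => 1) + 2 • (U * U' - V * V'))
          (of (fun _ _ => 1) + 2 • (U * U' + V * V'))) := by
  have e1 : (U + V) * (U' + V') + (U - V) * (U' - V') = 2 • (U * U' + V * V') := by
    noncomm_ring
  have e2 : (U + V) * (U' - V') + (U - V) * (U' + V') = 2 • (U * U' - V * V') := by
    noncomm_ring
  have e3 : (U - V) * (U' + V') + (U + V) * (U' - V') = 2 • (U * U' - V * V') := by
    noncomm_ring
  have e4 : (U - V) * (U' - V') + (U + V) * (U' + V') = 2 • (U * U' + V * V') := by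
    noncomm_ring
  rw [miyamoto, miyamoto, fromBlocks_multiply, fromBlocks_multiply, e1, e2, e3, e4]
  congr 1
  · ext
    simp [mul_apply]
    ring
  · ext i (j | j) <;>
      simp [mul_apply, sum_add_distrib, hu'] <;> ring
  · ext (i | i) j <;>
      simp [mul_apply, sum_add_distrib, hu] <;> ring
  · ext (i | i) (j | j) <;> simp [mul_apply]

theorem miyamoto_sum {ι : Type*} [Fintype ι] [DecidableEq ι] {U V : Fin 4 → Matrix ι ι ℤ}
    {u : Fin 4 → ℤ} (hUt : ∀ k, (U k)ᵀ = U k) (hu : ∀ k i, ∑ j, U k i j = u k)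
    (hu1 : ∑ k, u k = -1) (hc : ∑ k, (1 + 2 * u k) * (1 + 2 * u k) = 4)
    (hU : ∑ k, U k * U k = (2 * Fintype.card ι + 1 : ℤ) • 1 - of fun _ _ => 2)
    (hV : ∑ k, V k * V k = (2 * Fintype.card ι + 1 : ℤ) • 1) :
    ∑ k, miyamoto (1 + 2 * u k) (U k) (V k) * miyamoto (1 + 2 * u k) (U k) (V k) =
      ((4 * Fintype.card (Unit ⊕ ι ⊕ ι) : ℕ) : ℤ) • 1 := by
  have hu' : ∀ k j, ∑ i, U k i j = u k := fun k j => by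
    rw [← hu k j]
    exact Finset.sum_congr rfl fun i _ => congrFun₂ (hUt k) j i
  rw [Finset.sum_congr rfl fun k _ => miyamoto_mul (hu k) (hu' k)]
  have hU' := fun i j => congrFun₂ hU i j
  have hV' := fun i j => congrFun₂ hV i j
  simp only [Fin.sum_univ_four, Matrix.add_apply, Matrix.sub_apply, Matrix.smul_apply, of_apply]
    at hu1 hc hU' hV'
  ext (i | i | i) (j | j | j)
  all_goals
    simp only [Fin.sum_univ_four, Matrix.add_apply, Matrix.sub_apply, Matrix.smul_apply, of_apply,
      fromBlocks_apply₁₁, fromBlocks_apply₁₂, fromBlocks_apply₂₁, fromBlocks_apply₂₂, one_apply,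
      Fintype.card_sum, Fintype.card_unit, reduceCtorEq, Sum.inr.injEq, Sum.inl.injEq,
      if_true, if_false]
    push_cast
    simp only [smul_eq_mul, mul_one, mul_zero, nsmul_eq_mul, Nat.cast_ofNat]
  · linarith
  · linarith
  · linarith
  · linarith
  · have := hU' i j; have := hV' i j
    simp only [one_apply, smul_eq_mul] at *
    split_ifs at * <;> linarith
  · have := hU' i j; have := hV' i j
    simp only [one_apply, smul_eq_mul] at *
    split_ifs at * <;> linarith
  · linarith
  · have := hU' i j; have := hV' i j
    simp only [one_apply, smul_eq_mul] at *
    split_ifs at * <;> linarith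
  · have := hU' i j; have := hV' i j
    simp only [one_apply, smul_eq_mul] at *
    split_ifs at * <;> linarith

theorem miyamoto_comm {ι : Type*} [Fintype ι] {U V : Fin 4 → Matrix ι ι ℤ} {u : Fin 4 → ℤ}
    (hUt : ∀ k, (U k)ᵀ = U k) (hu : ∀ k i, ∑ j, U k i j = u k)
    (hU : ∀ k l, U k * U l = U l * U k) (hV : ∀ k l, V k * V l = V l * V k) (k l : Fin 4) :
    miyamoto (1 + 2 * u k) (U k) (V k) * miyamoto (1 + 2 * u l) (U l) (V l) =
      miyamoto (1 + 2 * u l) (U l) (V l) * miyamoto (1 + 2 * u k) (U k) (V k) := by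
  have hu' : ∀ k j, ∑ i, U k i j = u k := fun k j => by
    rw [← hu k j]
    exact Finset.sum_congr rfl fun i _ => congrFun₂ (hUt k) j i
  rw [miyamoto_mul (hu k) (hu' l), miyamoto_mul (hu l) (hu' k), hU k l, hV k l]
  congr 3 <;> ext <;> ring

/-- The quadratic character modulo an odd prime `p`, via Euler's criterion. -/
def eulerChar (p x : ℕ) : ℤ :=
  if x ^ (p / 2) % p = 0 then 0 else if x ^ (p / 2) % p = 1 then 1 else -1

/-- `χ(1 - 9^k)` modulo `113`, where `9` generates the nonzero squares. -/
def paleySquare (k : ZMod 56) : ℤ := eulerChar 113 (1 + 112 * (9 ^ k.val % 113))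

/-- `χ(3 - 9^k)` modulo `113`, where `3` is a nonsquare. -/
def paleyNonsquare (k : ZMod 56) : ℤ := eulerChar 113 (3 + 112 * (9 ^ k.val % 113))

theorem paleySquare_even : ∀ k, paleySquare (-k) = paleySquare k := by decide +kernel

theorem paleySquare_sum : ∑ k, paleySquare k = -1 := by decide +kernel

theorem paleyNonsquare_sum : ∑ k, paleyNonsquare k = 0 := by decide +kernel

theorem paley_autocorrelation : ∀ d, ∑ k, (paleySquare (d - k) * paleySquare (-k) +
    paleyNonsquare (d - k) * paleyNonsquare (-k)) = if d = 0 then 111 else -2 := by decide +kernel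

theorem paleySquare_entry : ∀ k, (k = 0 ∧ paleySquare k = 0) ∨
    (k ≠ 0 ∧ (paleySquare k = 1 ∨ paleySquare k = -1)) := by decide +kernel

theorem paleyNonsquare_entry : ∀ k, paleyNonsquare k = 1 ∨ paleyNonsquare k = -1 := by
  decide +kernel

/-- The entries of a symmetric conference matrix of order `14`. -/
def conferenceEntry : Option (ZMod 13) → Option (ZMod 13) → ℤ
  | none, none => 0
  | none, some _ => 1
  | some _, none => 1
  | some i, some j => eulerChar 13 (i - j).val

/-- A symmetric conference matrix of order `14`. -/
def conference14 : Matrix (Option (ZMod 13)) (Option (ZMod 13)) ℤ := of conferenceEntry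

theorem conference14_mul_self : conference14 * conference14 = (13 : ℤ) • 1 := by
  ext i j
  revert i j
  decide +kernel

theorem conferenceEntry_symm : ∀ i j, conferenceEntry i j = conferenceEntry j i := by
  decide +kernel

theorem conferenceEntry_entry : ∀ i j, (i = j ∧ conferenceEntry i j = 0) ∨
    (i ≠ j ∧ (conferenceEntry i j = 1 ∨ conferenceEntry i j = -1)) := by decide +kernel

theorem exists_symmetric_hadamard_double {n : Type*} [Fintype n] [DecidableEq n]
    {H : Matrix n n ℤ} (hH : ∀ i j, H i j = 1 ∨ H i j = -1) (hHt : Hᵀ = H)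
    (hHH : H * H = (Fintype.card n : ℤ) • 1) :
    ∃ K : Matrix (n ⊕ n) (n ⊕ n) ℤ, (∀ i j, K i j = 1 ∨ K i j = -1) ∧ Kᵀ = K ∧
      K * K = (Fintype.card (n ⊕ n) : ℤ) • 1 := by
  refine ⟨fromBlocks H H H (-H), ?_, ?_, ?_⟩
  · have hneg : ∀ i j, -H i j = 1 ∨ -H i j = -1 := fun i j => by have := hH i j; omega
    rintro (i | i) (j | j) <;> simp only [fromBlocks_apply₁₁, fromBlocks_apply₁₂,
      fromBlocks_apply₂₁, fromBlocks_apply₂₂, Matrix.neg_apply, hH, hneg]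
  · simp [fromBlocks_transpose, hHt]
  · rw [fromBlocks_multiply, ← fromBlocks_one, fromBlocks_smul]
    simp [hHH, ← two_mul]

/-- Paley's second construction: a symmetric conference matrix yields a symmetric Hadamard matrix
of twice the order. -/
theorem exists_symmetric_hadamard_of_conference {n : Type*} [Fintype n] [DecidableEq n]
    {C : Matrix n n ℤ} (hC : ∀ i j, (i = j ∧ C i j = 0) ∨ (i ≠ j ∧ (C i j = 1 ∨ C i j = -1)))
    (hCt : Cᵀ = C) (hCC : C * C = (Fintype.card n - 1 : ℤ) • 1) :
    ∃ K : Matrix (n ⊕ n) (n ⊕ n) ℤ, (∀ i j, K i j = 1 ∨ K i j = -1) ∧ Kᵀ = K ∧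
      K * K = (Fintype.card (n ⊕ n) : ℤ) • 1 := by
  refine ⟨fromBlocks (C + 1) (C - 1) (C - 1) (-C - 1), ?_, ?_, ?_⟩
  · rintro (i | i) (j | j) <;> rcases hC i j with ⟨rfl, h⟩ | ⟨hne, h | h⟩ <;> simp [*]
  · simp [fromBlocks_transpose, hCt]
  · have e1 : (C + 1) * (C + 1) + (C - 1) * (C - 1) = 2 • (C * C + 1) := by noncomm_ring
    have e2 : (C + 1) * (C - 1) + (C - 1) * (-C - 1) = 0 := by noncomm_ring
    have e3 : (C - 1) * (C + 1) + (-C - 1) * (C - 1) = 0 := by noncomm_ring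
    have e4 : (C - 1) * (C - 1) + (-C - 1) * (-C - 1) = 2 • (C * C + 1) := by noncomm_ring
    have e5 : 2 • (C * C + 1) = ((Fintype.card (n ⊕ n) : ℕ) : ℤ) • (1 : Matrix n n ℤ) := by
      rw [hCC, Fintype.card_sum]
      ext i j
      simp only [Matrix.smul_apply, Matrix.add_apply, one_apply, smul_eq_mul, nsmul_eq_mul]
      push_cast
      split_ifs <;> ring
    rw [fromBlocks_multiply, e1, e2, e3, e4, e5, ← fromBlocks_one, fromBlocks_smul]
    simp

theorem exists_symmetric_hadamard_56 :
    ∃ K : Matrix (ZMod 56) (ZMod 56) ℤ, (∀ i j, K i j = 1 ∨ K i j = -1) ∧ Kᵀ = K ∧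
      K * K = (56 : ℤ) • 1 := by
  obtain ⟨H, h1, h2, h3⟩ := exists_symmetric_hadamard_of_conference (C := conference14)
    conferenceEntry_entry (by ext i j; exact conferenceEntry_symm j i)
    (by rw [conference14_mul_self]; simp)
  obtain ⟨K, h1, h2, h3⟩ := exists_symmetric_hadamard_double h1 h2 h3
  have e := Fintype.equivOfCardEq (α := ZMod 56)
    (β := (Option (ZMod 13) ⊕ Option (ZMod 13)) ⊕ (Option (ZMod 13) ⊕ Option (ZMod 13)))
    (by simp)
  refine ⟨K.submatrix e e, fun i j => h1 _ _, ?_, ?_⟩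
  · rw [transpose_submatrix, h2]
  · rw [submatrix_mul_equiv, h3]
    ext i j
    simp only [Matrix.smul_apply, submatrix_apply, one_apply, EmbeddingLike.apply_eq_iff_eq,
      Fintype.card_sum, Fintype.card_option, ZMod.card]
    rfl

theorem vecCons_pair_zero_zero_comm {R : Type*} [Ring R] {a b : R} (h : a * b = b * a)
    (k l : Fin 4) : ![a, b, 0, 0] k * ![a, b, 0, 0] l = ![a, b, 0, 0] l * ![a, b, 0, 0] k := by
  fin_cases k <;> fin_cases l <;> simp [h]

theorem vecCons_one_zero_pair_comm {R : Type*} [Ring R] (a : R) (k l : Fin 4) :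
    ![1, 0, a, a] k * ![1, 0, a, a] l = ![1, 0, a, a] l * ![1, 0, a, a] k := by
  fin_cases k <;> fin_cases l <;> simp

/-- Symmetric commuting Williamson-type matrices of order `113`. -/
theorem exists_williamson_113 :
    ∃ X : Fin 4 → Matrix (Unit ⊕ ZMod 56 ⊕ ZMod 56) (Unit ⊕ ZMod 56 ⊕ ZMod 56) ℤ,
      (∀ k i j, X k i j = 1 ∨ X k i j = -1) ∧ (∀ k, (X k)ᵀ = X k) ∧
      (∀ k l, X k * X l = X l * X k) ∧
      ∑ k, X k * X k = ((4 * Fintype.card (Unit ⊕ ZMod 56 ⊕ ZMod 56) : ℕ) : ℤ) • 1 := by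
  obtain ⟨H, hH, hHt, hHH⟩ := exists_symmetric_hadamard_56
  set P : Matrix (ZMod 56) (ZMod 56) ℤ := of fun i j => paleySquare (i - j) with hP
  set N : Matrix (ZMod 56) (ZMod 56) ℤ := of fun i j => paleyNonsquare (i + j) with hN
  have hPt : Pᵀ = P := by
    ext i j
    simp only [hP, transpose_apply, of_apply]
    rw [← paleySquare_even, neg_sub]
  have hNt : Nᵀ = N := by
    ext i j
    simp only [hN, transpose_apply, of_apply, add_comm]
  have hPN : P * N = N * P := by
    ext i j
    simp only [hP, hN, mul_apply, of_apply]
    rw [← Equiv.sum_comp (Equiv.addRight (i - j))]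
    refine Finset.sum_congr rfl fun x _ => ?_
    rw [Equiv.coe_addRight, ← paleySquare_even, mul_comm]
    congr 2 <;> ring
  have hsum : P * P + N * N = (113 : ℤ) • 1 - of fun _ _ => 2 := by
    ext i j
    have hPP : (P * P) i j = ∑ k, paleySquare (i - j - k) * paleySquare (-k) := by
      simp only [hP, mul_apply, of_apply]
      rw [← Equiv.sum_comp (Equiv.addRight j)]
      refine Finset.sum_congr rfl fun x _ => ?_
      rw [Equiv.coe_addRight, paleySquare_even]
      congr 2 <;> ring
    have hNN : (N * N) i j = ∑ k, paleyNonsquare (i - j - k) * paleyNonsquare (-k) := by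
      simp only [hN, mul_apply, of_apply]
      rw [← Equiv.sum_comp (Equiv.subLeft (-j))]
      refine Finset.sum_congr rfl fun x _ => ?_
      rw [Equiv.subLeft_apply]
      congr 2 <;> ring
    rw [Matrix.add_apply, hPP, hNN, ← sum_add_distrib, paley_autocorrelation]
    simp only [Matrix.sub_apply, Matrix.smul_apply, one_apply, of_apply, sub_eq_zero]
    split_ifs <;> rfl
  let U : Fin 4 → Matrix (ZMod 56) (ZMod 56) ℤ := ![P, N, 0, 0]
  let V : Fin 4 → Matrix (ZMod 56) (ZMod 56) ℤ := ![1, 0, H, H]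
  let u : Fin 4 → ℤ := ![-1, 0, 0, 0]
  have hUt : ∀ k, (U k)ᵀ = U k := by
    intro k
    fin_cases k
    exacts [hPt, hNt, transpose_zero, transpose_zero]
  have hVt : ∀ k, (V k)ᵀ = V k := by
    intro k
    fin_cases k
    exacts [transpose_one, transpose_zero, hHt, hHt]
  have hUu : ∀ k i, ∑ j, U k i j = u k := by
    intro k i
    fin_cases k
    · exact (Equiv.sum_comp (Equiv.subLeft i) paleySquare).trans paleySquare_sum
    · exact (Equiv.sum_comp (Equiv.addLeft i) paleyNonsquare).trans paleyNonsquare_sum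
    · exact sum_const_zero
    · exact sum_const_zero
  refine ⟨fun k => miyamoto (1 + 2 * u k) (U k) (V k), ?_, ?_, ?_, ?_⟩
  · have hUV : ∀ k i j, (U k i j + V k i j = 1 ∨ U k i j + V k i j = -1) ∧
        (U k i j - V k i j = 1 ∨ U k i j - V k i j = -1) := by
      intro k i j
      fin_cases k
      · change (P i j + (1 : Matrix _ _ ℤ) i j = 1 ∨ P i j + (1 : Matrix _ _ ℤ) i j = -1) ∧
          (P i j - (1 : Matrix _ _ ℤ) i j = 1 ∨ P i j - (1 : Matrix _ _ ℤ) i j = -1)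
        rcases paleySquare_entry (i - j) with ⟨h, h'⟩ | ⟨h, h'⟩
        · rw [show P i j = 0 from h', one_apply, if_pos (sub_eq_zero.mp h)]
          decide
        · rw [one_apply, if_neg (sub_ne_zero.mp h), add_zero, sub_zero]
          exact ⟨h', h'⟩
      · change (N i j + 0 = 1 ∨ N i j + 0 = -1) ∧ (N i j - 0 = 1 ∨ N i j - 0 = -1)
        rw [add_zero, sub_zero]
        exact ⟨paleyNonsquare_entry (i + j), paleyNonsquare_entry (i + j)⟩
      all_goals
        change (0 + H i j = 1 ∨ 0 + H i j = -1) ∧ (0 - H i j = 1 ∨ 0 - H i j = -1)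
        have := hH i j
        omega
    have hc : ∀ k, 1 + 2 * u k = 1 ∨ 1 + 2 * u k = -1 := by decide
    rintro k (i | i | i) (j | j | j)
    · exact hc k
    all_goals first
      | exact Or.inl rfl
      | exact (hUV k i j).1
      | exact (hUV k i j).2
  · intro k
    simp only [miyamoto, fromBlocks_transpose, transpose_add, transpose_sub, hUt, hVt]
    rfl
  · exact miyamoto_comm hUt hUu (vecCons_pair_zero_zero_comm hPN) (vecCons_one_zero_pair_comm H)
  · refine miyamoto_sum hUt hUu (by decide) (by decide) ?_ ?_
    · rw [Fin.sum_univ_four, ZMod.card]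
      change P * P + N * N + 0 * 0 + 0 * 0 = _
      rw [Matrix.mul_zero, add_zero, add_zero, hsum]
      norm_num only
    · rw [Fin.sum_univ_four, ZMod.card]
      change 1 * 1 + 0 * 0 + H * H + H * H = _
      rw [Matrix.mul_zero, Matrix.mul_one, add_zero, hHH]
      module

/-- There exists a Hadamard matrix of order `32996 = 4 · 8249`. -/
theorem hadamard_32996 :
    ∃ H : Matrix (Fin (4 * 8249)) (Fin (4 * 8249)) ℤ, IsHadamardMatrix H := by
  obtain ⟨X, hentry, hXt, hX, hsum⟩ := exists_williamson_113
  obtain ⟨H, hH⟩ := exists_isHadamardMatrix_of_tMatrices tSeq_entry tSeq_circulant hentry hXt hX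
    hsum
  exact ⟨_, hH.reindex (Fintype.equivOfCardEq (by
    simp only [Fintype.card_prod, Fintype.card_sum, Fintype.card_fin, ZMod.card,
      Fintype.card_unit]))⟩
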